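/- Let a = (w_1, …, w_n) be a CLT sentence whose words contain no self-edge. Then n is even and there exists a permutation σ of {1, …, n} such that: (a) a_i = (w_{σ(2i−1)}, w_{σ(2i)}) is a CLT pair for each i = 1, …, n/2; (b) the edge sets E_1, …, E_{n/2} of the graphs of a_1, …, a_{n/2} are pairwise disjoint; (c) the sets V_i \ {1}, i = 1, …, n/2, where V_i is the vertex set of the graph of a_i, are pairwise disjoint. -/

import Mathlib

/-- The list of edges (unordered pairs of adjacent letters) traversed by the word `w`. -/
def edgeList (w : List ℕ) : List (Sym2 ℕ) :=
  (w.zip w.tail).map fun p => s(p.1, p.2)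

/-- The edge set `E_w` of the graph `G_w` of the word `w`. -/
def edgeFinset (w : List ℕ) : Finset (Sym2 ℕ) := (edgeList w).toFinset

/-- The traversal count `N_e^w`: the number of times the walk `w` traverses the edge `e`
(in either direction). -/
def trav (w : List ℕ) (e : Sym2 ℕ) : ℕ := (edgeList w).count e

/-- The support of a word: the set of letters appearing in it. -/
def wsupp (w : List ℕ) : Finset ℕ := w.toFinset

/-- A word is a closed word starting at the letter `1`: a finite sequence of positive
integers whose first and last letters are both equal to `1`. -/
def IsClosedWordAtOne (w : List ℕ) : Prop :=
  w ≠ [] ∧ w.head? = some 1 ∧ w.getLast? = some 1 ∧ ∀ x ∈ w, 0 < x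

/-- `(w₁, w₂)` is a weak CLT pair: both are closed words starting at `1`, every edge of the
combined graph is traversed at least twice in total, and the two words share an edge. -/
def IsWeakCLTPair (w₁ w₂ : List ℕ) : Prop :=
  IsClosedWordAtOne w₁ ∧ IsClosedWordAtOne w₂ ∧
    (∀ e ∈ edgeFinset w₁ ∪ edgeFinset w₂, 2 ≤ trav w₁ e + trav w₂ e) ∧
    (edgeFinset w₁ ∩ edgeFinset w₂).Nonempty


/-- The list of all edge-traversals of the sentence `a = (w₁, …, wₙ)`. -/
def sentEdgeList (a : List (List ℕ)) : List (Sym2 ℕ) := (a.map edgeList).flatten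

/-- The edge set `E_a` of the graph `G_a` of the sentence `a`. -/
def sentEdgeFinset (a : List (List ℕ)) : Finset (Sym2 ℕ) := (sentEdgeList a).toFinset

/-- The total traversal count `N_e^a` of the edge `e` by the walks of the sentence `a`. -/
def sentTrav (a : List (List ℕ)) (e : Sym2 ℕ) : ℕ := (sentEdgeList a).count e

/-- The support of a sentence: the union of the supports of its words. -/
def sentSupp (a : List (List ℕ)) : Finset ℕ := a.flatten.toFinset

/-- `a = (w₁, …, wₙ)` is a weak CLT sentence: it consists of at least one word, all its words
are closed words starting at `1`, every edge of `G_a` is traversed at least twice in total,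
and every word shares an edge with some other word of the sentence. -/
def IsWeakCLTSentence (a : List (List ℕ)) : Prop :=
  a ≠ [] ∧ (∀ w ∈ a, IsClosedWordAtOne w) ∧
    (∀ e ∈ sentEdgeFinset a, 2 ≤ sentTrav a e) ∧
    ∀ i : Fin a.length, ∃ j : Fin a.length, j ≠ i ∧
      (edgeFinset (a.get i) ∩ edgeFinset (a.get j)).Nonempty

/-- `a` is a CLT sentence: a weak CLT sentence with
`wt(a) = 1 + Σᵢ (ℓ(wᵢ) - 2)/2`. -/
def IsCLTSentence (a : List (List ℕ)) : Prop :=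
  IsWeakCLTSentence a ∧
    ((sentSupp a).card : ℚ) = 1 + ∑ i : Fin a.length, (((a.get i).length : ℚ) - 2) / 2

/-- `(w₁, w₂)` is a CLT pair: a weak CLT pair with `wt = (ℓ(w₁) + ℓ(w₂))/2 - 1`. -/
def IsCLTPair (w₁ w₂ : List ℕ) : Prop :=
  IsWeakCLTPair w₁ w₂ ∧
    ((wsupp w₁ ∪ wsupp w₂).card : ℚ) = ((w₁.length : ℚ) + w₂.length) / 2 - 1

/-! ### Edges traversed by a closed word -/

lemma edgeList_cons_cons (x y : ℕ) (l : List ℕ) :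
    edgeList (x :: y :: l) = s(x, y) :: edgeList (y :: l) := rfl

lemma length_edgeList (w : List ℕ) : (edgeList w).length = w.length - 1 := by
  simp [edgeList]

lemma mem_edgeFinset {w : List ℕ} {e : Sym2 ℕ} : e ∈ edgeFinset w ↔ 1 ≤ trav w e := by
  simp [edgeFinset, trav, List.one_le_count_iff]

lemma trav_eq_zero {w : List ℕ} {e : Sym2 ℕ} (h : e ∉ edgeFinset w) : trav w e = 0 := by
  rw [mem_edgeFinset] at h
  omega

lemma mem_wsupp_of_mem_edgeList {w : List ℕ} {e : Sym2 ℕ} (he : e ∈ edgeList w) {u : ℕ}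
    (hu : u ∈ e) : u ∈ wsupp w := by
  obtain ⟨⟨x, y⟩, hp, rfl⟩ := List.mem_map.1 he
  obtain ⟨hx, hy⟩ := List.of_mem_zip hp
  rcases Sym2.mem_iff.1 hu with rfl | rfl
  · simpa [wsupp] using hx
  · simpa [wsupp] using List.mem_of_mem_tail hy

lemma sum_trav {w : List ℕ} {S : Finset (Sym2 ℕ)} (hS : edgeFinset w ⊆ S) :
    ∑ e ∈ S, trav w e = w.length - 1 := by
  rw [← length_edgeList, ← List.sum_toFinset_count_eq_length]
  exact (Finset.sum_subset hS fun e _ he => trav_eq_zero he).symm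

lemma IsClosedWordAtOne.one_mem_wsupp {w : List ℕ} (hw : IsClosedWordAtOne w) :
    1 ∈ wsupp w := by
  simpa [wsupp] using List.mem_of_mem_head? hw.2.1

/-- The mod-`2` boundary `u + v` of the edge `{u, v}`. -/
noncomputable def bdry (e : Sym2 ℕ) : ℕ →₀ ZMod 2 :=
  Sym2.lift ⟨fun u v => Finsupp.single u 1 + Finsupp.single v 1, fun _ _ => add_comm _ _⟩ e

lemma bdry_mk (u v : ℕ) : bdry s(u, v) = Finsupp.single u 1 + Finsupp.single v 1 := rfl

lemma bdry_ne_zero {e : Sym2 ℕ} (he : ¬ e.IsDiag) : bdry e ≠ 0 := by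
  induction e using Sym2.ind with
  | _ u v =>
    rw [Sym2.mk_isDiag_iff] at he
    intro h
    have := DFunLike.congr_fun h u
    simp [bdry_mk, Ne.symm he] at this

lemma sum_bdry_edgeList (x : ℕ) (l : List ℕ) :
    ((edgeList (x :: l)).map bdry).sum =
      Finsupp.single x 1 + Finsupp.single ((x :: l).getLast (by simp)) 1 := by
  induction l generalizing x with
  | nil => simp [edgeList, ZModModule.add_self]
  | cons y l ih =>
    rw [edgeList_cons_cons, List.map_cons, List.sum_cons, ih, bdry_mk,
      List.getLast_cons (by simp : y :: l ≠ []), add_assoc, ← add_assoc (Finsupp.single y 1),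
      ZModModule.add_self, zero_add]

lemma IsClosedWordAtOne.sum_trav_smul_bdry {w : List ℕ} (hw : IsClosedWordAtOne w)
    {S : Finset (Sym2 ℕ)} (hS : edgeFinset w ⊆ S) :
    ∑ e ∈ S, (trav w e : ZMod 2) • bdry e = 0 := by
  obtain ⟨hne, hh, hl, -⟩ := hw
  have h0 : ((edgeList w).map bdry).sum = 0 := by
    cases w with
    | nil => exact absurd rfl hne
    | cons x l =>
      rw [sum_bdry_edgeList]
      rw [List.getLast?_eq_some_getLast hne] at hl
      rw [Option.some.inj hl, show x = 1 by simpa using hh, ZModModule.add_self]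
  rw [Finset.sum_list_map_count] at h0
  rw [← Finset.sum_subset hS fun e _ he => by simp [trav_eq_zero he], ← h0]
  exact Finset.sum_congr rfl fun e _ => by rw [Nat.cast_smul_eq_nsmul, trav]

lemma single_add_single_mem_span (x : ℕ) (l : List ℕ) {v : ℕ} (hv : v ∈ x :: l) :
    (Finsupp.single v 1 + Finsupp.single x 1 : ℕ →₀ ZMod 2) ∈
      Submodule.span (ZMod 2) (bdry '' edgeFinset (x :: l)) := by
  induction l generalizing x with
  | nil =>
    obtain rfl : v = x := by simpa using hv
    rw [ZModModule.add_self]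
    exact zero_mem _
  | cons y l ih =>
    rcases List.mem_cons.1 hv with rfl | hv
    · rw [ZModModule.add_self]
      exact zero_mem _
    have hsub : edgeFinset (y :: l) ⊆ edgeFinset (x :: y :: l) := by
      intro e he
      simp only [edgeFinset, List.mem_toFinset, edgeList_cons_cons, List.mem_cons] at he ⊢
      exact Or.inr he
    have h1 := Submodule.span_mono (R := ZMod 2) (Set.image_mono (f := bdry)
      (Finset.coe_subset.2 hsub)) (ih y hv)
    have h2 : bdry s(x, y) ∈
        Submodule.span (ZMod 2) (bdry '' edgeFinset (x :: y :: l)) :=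
      Submodule.subset_span ⟨_, by simp [edgeFinset, edgeList_cons_cons], rfl⟩
    have h3 := add_mem h1 h2
    rwa [bdry_mk, add_comm (Finsupp.single x 1), add_assoc, ← add_assoc (Finsupp.single y 1),
      ZModModule.add_self, zero_add] at h3

/-! ### Spanning trees as bases of the graphic matroid -/

/-- `τ` is the edge set of a spanning forest of the graph with edge set `E`: the boundaries of
its edges form a basis of the span of all edge boundaries. -/
structure IsSpanningForest (E τ : Finset (Sym2 ℕ)) : Prop where
  subset : τ ⊆ E
  indep : LinearIndepOn (ZMod 2) bdry (τ : Set (Sym2 ℕ))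
  span : ∀ e ∈ E, bdry e ∈ Submodule.span (ZMod 2) (bdry '' τ)

/-- `e` is a bridge of the graph with edge set `E`. -/
def IsBridgeIn (E : Finset (Sym2 ℕ)) (e : Sym2 ℕ) : Prop :=
  bdry e ∉ Submodule.span (ZMod 2) (bdry '' (E.erase e))

lemma exists_isSpanningForest_extending {E s : Finset (Sym2 ℕ)} (hs : s ⊆ E)
    (h : LinearIndepOn (ZMod 2) bdry (s : Set (Sym2 ℕ))) :
    ∃ τ, IsSpanningForest E τ ∧ s ⊆ τ := by
  obtain ⟨b, hbE, hsb, hspan, hb⟩ := exists_linearIndepOn_extension h (Finset.coe_subset.2 hs)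
  lift b to Finset (Sym2 ℕ) using E.finite_toSet.subset hbE
  exact ⟨b, ⟨Finset.coe_subset.1 hbE, hb, fun e he => hspan ⟨e, he, rfl⟩⟩,
    Finset.coe_subset.1 hsb⟩

lemma exists_isSpanningForest (E : Finset (Sym2 ℕ)) : ∃ τ, IsSpanningForest E τ := by
  obtain ⟨τ, h, -⟩ := exists_isSpanningForest_extending (E := E) (Finset.empty_subset _)
    (by simp)
  exact ⟨τ, h⟩

lemma exists_isSpanningForest_mem {E : Finset (Sym2 ℕ)} {e : Sym2 ℕ} (he : e ∈ E)
    (hd : ¬ e.IsDiag) : ∃ τ, IsSpanningForest E τ ∧ e ∈ τ := by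
  obtain ⟨τ, h, hτ⟩ := exists_isSpanningForest_extending (E := E) (s := {e}) (by simpa using he)
    (by simpa [linearIndepOn_singleton_iff] using bdry_ne_zero hd)
  exact ⟨τ, h, by simpa using hτ⟩

lemma exists_isSpanningForest_notMem {E : Finset (Sym2 ℕ)} {e : Sym2 ℕ}
    (he : ¬ IsBridgeIn E e) : ∃ τ, IsSpanningForest E τ ∧ e ∉ τ := by
  obtain ⟨τ, h⟩ := exists_isSpanningForest (E.erase e)
  refine ⟨τ, ⟨h.subset.trans (Finset.erase_subset _ _), h.indep, fun f hf => ?_⟩,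
    fun h' => by simpa using h.subset h'⟩
  by_cases hfe : f = e
  · subst hfe
    refine Submodule.span_le.2 ?_ (not_not.1 he)
    rintro _ ⟨g, hg, rfl⟩
    exact h.span g hg
  · exact h.span f (Finset.mem_erase.2 ⟨hfe, hf⟩)

/-- A closed word crosses a bridge an even number of times. -/
lemma even_trav_of_isBridgeIn {E : Finset (Sym2 ℕ)} {e : Sym2 ℕ} {w : List ℕ}
    (hw : IsClosedWordAtOne w) (hE : edgeFinset w ⊆ E) (he : IsBridgeIn E e) :
    Even (trav w e) := by
  by_contra hodd
  have heE : e ∈ E := hE (mem_edgeFinset.2 (Nat.not_even_iff_odd.1 hodd).pos)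
  have h := hw.sum_trav_smul_bdry hE
  rw [← Finset.add_sum_erase _ _ heE,
    ZMod.natCast_eq_one_iff_odd.2 (Nat.not_even_iff_odd.1 hodd), one_smul] at h
  refine he ?_
  rw [eq_neg_of_add_eq_zero_left h]
  exact neg_mem (Submodule.sum_mem _ fun f hf =>
    Submodule.smul_mem _ _ (Submodule.subset_span ⟨f, hf, rfl⟩))

/-- A closed word inside a forest crosses every edge an even number of times. -/
lemma IsSpanningForest.even_trav {E τ : Finset (Sym2 ℕ)} (hτ : IsSpanningForest E τ)
    {w : List ℕ} (hw : IsClosedWordAtOne w) (hsub : edgeFinset w ⊆ τ) (e : Sym2 ℕ) :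
    Even (trav w e) := by
  by_cases he : e ∈ τ
  · exact ZMod.natCast_eq_zero_iff_even.1
      (linearIndepOn_finset_iff.1 hτ.indep _ (hw.sum_trav_smul_bdry hsub) e he)
  · simp [trav_eq_zero fun h => he (hsub h)]

/-- Two closed words that both cross the edge `f` outside the forest `τ` exactly once, and no
other edge outside `τ`, cross every edge of `τ` equally often modulo `2`. -/
lemma IsSpanningForest.trav_mod_two {E τ : Finset (Sym2 ℕ)} (hτ : IsSpanningForest E τ)
    {w w' : List ℕ} (hw : IsClosedWordAtOne w) (hw' : IsClosedWordAtOne w') {f : Sym2 ℕ}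
    (hf : f ∉ τ) (hsub : edgeFinset w ⊆ insert f τ) (hsub' : edgeFinset w' ⊆ insert f τ)
    (h1 : trav w f = 1) (h1' : trav w' f = 1) {e : Sym2 ℕ} (he : e ∈ τ) :
    (trav w e : ZMod 2) = trav w' e := by
  have h := hw.sum_trav_smul_bdry hsub
  have h' := hw'.sum_trav_smul_bdry hsub'
  rw [Finset.sum_insert hf, h1] at h
  rw [Finset.sum_insert hf, h1'] at h'
  have key : ∑ e ∈ τ, ((trav w e : ZMod 2) - trav w' e) • bdry e = 0 := by
    simp_rw [sub_smul]
    rw [Finset.sum_sub_distrib, sub_eq_zero]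
    exact add_left_cancel (h.trans h'.symm)
  exact sub_eq_zero.1 (linearIndepOn_finset_iff.1 hτ.indep _ key e he)

/-- The number of edges of a spanning tree is the number of vertices minus one. -/
lemma IsSpanningForest.card_add_one {ι : Type*} [Fintype ι] [Nonempty ι] {w : ι → List ℕ}
    (hw : ∀ i, IsClosedWordAtOne (w i)) {τ : Finset (Sym2 ℕ)}
    (hτ : IsSpanningForest (Finset.univ.biUnion fun i => edgeFinset (w i)) τ) :
    τ.card + 1 = (Finset.univ.biUnion fun i => wsupp (w i)).card := by
  classical
  set E := Finset.univ.biUnion fun i => edgeFinset (w i) with hE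
  set V := Finset.univ.biUnion fun i => wsupp (w i) with hV
  let δ : ℕ → ℕ →₀ ZMod 2 := fun v => Finsupp.single v 1
  have hδ : LinearIndependent (ZMod 2) δ := Finsupp.linearIndependent_single_one _ _
  have hE_span : Submodule.span (ZMod 2) (bdry '' E) = Submodule.span (ZMod 2) (bdry '' τ) := by
    refine le_antisymm (Submodule.span_le.2 ?_)
      (Submodule.span_mono (Set.image_mono (Finset.coe_subset.2 hτ.subset)))
    rintro _ ⟨e, he, rfl⟩
    exact hτ.span e he
  -- the augmentation map vanishes on boundaries, but not on a vertex
  have hone : δ 1 ∉ Submodule.span (ZMod 2) (bdry '' τ) := by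
    let aug : (ℕ →₀ ZMod 2) →ₗ[ZMod 2] ZMod 2 := Finsupp.lsum (ZMod 2) fun _ => LinearMap.id
    intro h
    have hle : Submodule.span (ZMod 2) (bdry '' τ) ≤ LinearMap.ker aug := by
      refine Submodule.span_le.2 ?_
      rintro _ ⟨e, -, rfl⟩
      induction e using Sym2.ind with
      | _ u v =>
        simp only [SetLike.mem_coe, LinearMap.mem_ker, bdry_mk, aug, map_add]
        simp [CharTwo.add_self_eq_zero]
    have := LinearMap.mem_ker.1 (hle h)
    simp [aug, δ] at this
  have hBi : LinearIndepOn (ZMod 2) id (insert (δ 1) (bdry '' τ)) :=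
    hτ.indep.id_image.id_insert hone
  have hVi : LinearIndepOn (ZMod 2) id (δ '' V) := (hδ.linearIndepOn (s := (V : Set ℕ))).id_image
  have hspan : Submodule.span (ZMod 2) (insert (δ 1) (bdry '' τ)) =
      Submodule.span (ZMod 2) (δ '' V) := by
    refine le_antisymm (Submodule.span_le.2 ?_) (Submodule.span_le.2 ?_)
    · rintro x (rfl | ⟨e, he, rfl⟩)
      · obtain ⟨i⟩ := ‹Nonempty ι›
        exact Submodule.subset_span ⟨1, by
          simpa [hV] using ⟨i, (hw i).one_mem_wsupp⟩, rfl⟩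
      · obtain ⟨i, -, hi⟩ := Finset.mem_biUnion.1 (hτ.subset he)
        have hmem : ∀ u ∈ e, δ u ∈ Submodule.span (ZMod 2) (δ '' V) := fun u hu =>
          Submodule.subset_span ⟨u, Finset.mem_biUnion.2 ⟨i, Finset.mem_univ _,
            mem_wsupp_of_mem_edgeList (by simpa [edgeFinset] using hi) hu⟩, rfl⟩
        induction e using Sym2.ind with
        | _ u v => exact add_mem (hmem u (by simp)) (hmem v (by simp))
    · rintro _ ⟨v, hv, rfl⟩
      obtain ⟨i, -, hi⟩ := Finset.mem_biUnion.1 hv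
      have h1 : δ v + δ 1 ∈ Submodule.span (ZMod 2) (bdry '' edgeFinset (w i)) := by
        have hwi := hw i
        cases hwl : w i with
        | nil => exact absurd hwl hwi.1
        | cons x l =>
          rw [hwl] at hwi hi
          obtain rfl : x = 1 := by simpa using hwi.2.1
          exact single_add_single_mem_span 1 l (by simpa [wsupp] using hi)
      have h2 : δ v + δ 1 ∈ Submodule.span (ZMod 2) (insert (δ 1) (bdry '' τ)) := by
        refine Submodule.span_mono (Set.subset_insert _ _) (hE_span ▸ Submodule.span_mono
          (Set.image_mono (Finset.coe_subset.2 ?_)) h1)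
        exact Finset.subset_biUnion_of_mem (fun i => edgeFinset (w i)) (Finset.mem_univ i)
      have h3 := add_mem h2 (Submodule.subset_span (R := ZMod 2)
        (Set.mem_insert (δ 1) (bdry '' τ)))
      rwa [add_assoc, ZModModule.add_self, add_zero] at h3
  have hinj : Set.InjOn bdry (τ : Set (Sym2 ℕ)) := hτ.indep.injOn
  have hB : Module.finrank (ZMod 2) (Submodule.span (ZMod 2) (insert (δ 1) (bdry '' τ))) =
      τ.card + 1 := by
    have hcoe : insert (δ 1) (bdry '' τ) = ((insert (δ 1) (τ.image bdry) : Finset _) : Set _) := by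
      simp
    rw [hcoe] at hBi ⊢
    rw [finrank_span_finset_eq_card hBi, Finset.card_insert_of_notMem,
      Finset.card_image_of_injOn hinj]
    intro h
    exact hone (Submodule.subset_span (by simpa using h))
  have hVc : Module.finrank (ZMod 2) (Submodule.span (ZMod 2) (δ '' V)) = V.card := by
    rw [← Finset.coe_image] at hVi ⊢
    rw [finrank_span_finset_eq_card hVi, Finset.card_image_of_injective _ hδ.injective]
  rw [← hB, hspan, hVc]

/-! ### The traversal count of a family of closed words -/

section Family

variable {ι : Type*} [Fintype ι]

/-- The union of the edge sets of a family of words. -/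
def familyEdges (w : ι → List ℕ) : Finset (Sym2 ℕ) :=
  Finset.univ.biUnion fun i => edgeFinset (w i)

lemma edgeFinset_subset_familyEdges (w : ι → List ℕ) (i : ι) :
    edgeFinset (w i) ⊆ familyEdges w :=
  Finset.subset_biUnion_of_mem (fun i => edgeFinset (w i)) (Finset.mem_univ i)

/-- The union of the supports of a family of words. -/
def familySupp (w : ι → List ℕ) : Finset ℕ :=
  Finset.univ.biUnion fun i => wsupp (w i)

/-- The total traversal count of an edge by a family of words. -/
def familyTrav (w : ι → List ℕ) (e : Sym2 ℕ) : ℕ := ∑ i, trav (w i) e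

/-- A family of closed words traversing each of its edges at least twice in total. -/
structure IsDoublyTraversed (w : ι → List ℕ) : Prop where
  closed : ∀ i, IsClosedWordAtOne (w i)
  two_le : ∀ e ∈ familyEdges w, 2 ≤ familyTrav w e

/-- `c` selects, for each word of the family, an edge shared with some other word. -/
def IsSharedChoice (w : ι → List ℕ) (c : ι → Sym2 ℕ) : Prop :=
  ∀ i, c i ∈ edgeFinset (w i) ∧ ∃ j, j ≠ i ∧ c i ∈ edgeFinset (w j)

open Classical in
/-- The words inside the forest `τ` whose selected edge is `e`. -/
noncomputable def forestWordsAt (w : ι → List ℕ) (τ : Finset (Sym2 ℕ)) (c : ι → Sym2 ℕ)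
    (e : Sym2 ℕ) : Finset ι :=
  Finset.univ.filter fun i => edgeFinset (w i) ⊆ τ ∧ c i = e

lemma mem_forestWordsAt {w : ι → List ℕ} {τ : Finset (Sym2 ℕ)} {c : ι → Sym2 ℕ} {e : Sym2 ℕ}
    {i : ι} : i ∈ forestWordsAt w τ c e ↔ edgeFinset (w i) ⊆ τ ∧ c i = e := by
  simp [forestWordsAt]

lemma sum_trav_le_familyTrav (w : ι → List ℕ) (e : Sym2 ℕ) (s : Finset ι) :
    ∑ i ∈ s, trav (w i) e ≤ familyTrav w e :=
  Finset.sum_le_sum_of_subset (Finset.subset_univ s)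

lemma two_mul_card_le_familyTrav {w : ι → List ℕ} {e : Sym2 ℕ} {s : Finset ι}
    (hs : ∀ i ∈ s, e ∈ edgeFinset (w i)) (heven : ∀ i ∈ s, Even (trav (w i) e)) :
    2 * s.card ≤ familyTrav w e := by
  refine le_trans ?_ (sum_trav_le_familyTrav w e s)
  rw [mul_comm, ← smul_eq_mul]
  refine Finset.card_nsmul_le_sum _ _ _ fun i hi => ?_
  obtain ⟨k, hk⟩ := heven i hi
  have := mem_edgeFinset.1 (hs i hi)
  omega

lemma card_forestWordsAt_add_two_le {w : ι → List ℕ} (hw : IsDoublyTraversed w)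
    {τ : Finset (Sym2 ℕ)} (hτ : IsSpanningForest (familyEdges w) τ) {c : ι → Sym2 ℕ}
    (hc : IsSharedChoice w c) {e : Sym2 ℕ} (he : e ∈ τ) :
    (forestWordsAt w τ c e).card + 2 ≤ familyTrav w e := by
  classical
  have hmem : ∀ i ∈ forestWordsAt w τ c e, e ∈ edgeFinset (w i) := fun i hi =>
    (mem_forestWordsAt.1 hi).2 ▸ (hc i).1
  have heven : ∀ i ∈ forestWordsAt w τ c e, Even (trav (w i) e) := fun i hi =>
    hτ.even_trav (hw.closed i) (mem_forestWordsAt.1 hi).1 e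
  have h2 := two_mul_card_le_familyTrav hmem heven
  have h2' := hw.two_le e (hτ.subset he)
  rcases Nat.lt_trichotomy (forestWordsAt w τ c e).card 1 with h | h | h
  · omega
  · obtain ⟨i, hi⟩ := Finset.card_eq_one.1 h
    have hi : i ∈ forestWordsAt w τ c e := by simp [hi]
    obtain ⟨j, hji, hj⟩ := (hc i).2
    rw [(mem_forestWordsAt.1 hi).2] at hj
    have h3 := sum_trav_le_familyTrav w e {j, i}
    rw [Finset.sum_pair hji] at h3
    have h4 := mem_edgeFinset.1 hj
    have h5 := mem_edgeFinset.1 (hmem i hi)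
    obtain ⟨k, hk⟩ := heven i hi
    omega
  · omega

lemma sum_length_sub_one {w : ι → List ℕ} {τ : Finset (Sym2 ℕ)} (hτ : τ ⊆ familyEdges w) :
    ∑ i, ((w i).length - 1) =
      (∑ i, ∑ e ∈ familyEdges w \ τ, trav (w i) e) + ∑ e ∈ τ, familyTrav w e := by
  simp only [familyTrav]
  rw [Finset.sum_comm (s := τ), ← Finset.sum_add_distrib]
  exact Finset.sum_congr rfl fun i _ => by
    rw [Finset.sum_sdiff hτ, sum_trav (edgeFinset_subset_familyEdges w i)]

open Classical in
lemma card_eq_sum_forestWordsAt {w : ι → List ℕ} {τ : Finset (Sym2 ℕ)} {c : ι → Sym2 ℕ}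
    (hc : IsSharedChoice w c) :
    Fintype.card ι = (∑ i, if edgeFinset (w i) ⊆ τ then 0 else 1) +
      ∑ e ∈ τ, (forestWordsAt w τ c e).card := by
  have h1 : ∑ e ∈ τ, (forestWordsAt w τ c e).card =
      (Finset.univ.filter fun i => edgeFinset (w i) ⊆ τ).card := by
    rw [Finset.card_eq_sum_card_fiberwise (f := c) (t := τ)]
    · refine Finset.sum_congr rfl fun e _ => ?_
      rw [Finset.filter_filter, forestWordsAt]
    · intro i hi
      exact (Finset.mem_filter.1 hi).2 (hc i).1
  rw [h1, Finset.card_filter, ← Finset.sum_add_distrib, ← Finset.card_univ,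
    Finset.card_eq_sum_ones]
  exact Finset.sum_congr rfl fun i _ => by split_ifs <;> rfl

lemma one_le_sum_trav_sdiff {w : ι → List ℕ} {τ : Finset (Sym2 ℕ)} {i : ι}
    (hi : ¬ edgeFinset (w i) ⊆ τ) : 1 ≤ ∑ e ∈ familyEdges w \ τ, trav (w i) e := by
  obtain ⟨e, he, heτ⟩ := Finset.not_subset.1 hi
  exact (mem_edgeFinset.1 he).trans (Finset.single_le_sum (f := fun e => trav (w i) e)
    (fun _ _ => Nat.zero_le _)
    (Finset.mem_sdiff.2 ⟨edgeFinset_subset_familyEdges w i he, heτ⟩))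

/-- The number of words is at most the excess of traversals over twice a spanning forest. -/
lemma card_add_two_mul_le {w : ι → List ℕ} (hw : IsDoublyTraversed w)
    {τ : Finset (Sym2 ℕ)} (hτ : IsSpanningForest (familyEdges w) τ) {c : ι → Sym2 ℕ}
    (hc : IsSharedChoice w c) :
    Fintype.card ι + 2 * τ.card ≤ ∑ i, ((w i).length - 1) := by
  classical
  rw [sum_length_sub_one hτ.subset, card_eq_sum_forestWordsAt (τ := τ) hc, add_assoc,
    mul_comm, ← smul_eq_mul, ← Finset.sum_const, ← Finset.sum_add_distrib]
  refine add_le_add (Finset.sum_le_sum fun i _ => ?_)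
    (Finset.sum_le_sum fun e he => card_forestWordsAt_add_two_le hw hτ hc he)
  split_ifs with h
  · exact Nat.zero_le _
  · exact one_le_sum_trav_sdiff h

/-- In a tight family, every term of the counting bound is attained. -/
lemma eq_of_card_add_two_mul_eq {w : ι → List ℕ} (hw : IsDoublyTraversed w)
    {τ : Finset (Sym2 ℕ)} (hτ : IsSpanningForest (familyEdges w) τ) {c : ι → Sym2 ℕ}
    (hc : IsSharedChoice w c)
    (heq : Fintype.card ι + 2 * τ.card = ∑ i, ((w i).length - 1)) :
    (∀ i, ¬ edgeFinset (w i) ⊆ τ → ∑ e ∈ familyEdges w \ τ, trav (w i) e = 1) ∧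
      ∀ e ∈ τ, familyTrav w e = (forestWordsAt w τ c e).card + 2 := by
  classical
  rw [sum_length_sub_one hτ.subset, card_eq_sum_forestWordsAt (τ := τ) hc, add_assoc,
    mul_comm, ← smul_eq_mul, ← Finset.sum_const, ← Finset.sum_add_distrib] at heq
  have h1 : ∀ i ∈ Finset.univ, (if edgeFinset (w i) ⊆ τ then 0 else 1) ≤
      ∑ e ∈ familyEdges w \ τ, trav (w i) e := fun i _ => by
    split_ifs with h
    · exact Nat.zero_le _
    · exact one_le_sum_trav_sdiff h
  have h2 : ∀ e ∈ τ, (forestWordsAt w τ c e).card + 2 ≤ familyTrav w e := fun e he =>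
    card_forestWordsAt_add_two_le hw hτ hc he
  have h1' := Finset.sum_le_sum h1
  have h2' := Finset.sum_le_sum h2
  refine ⟨fun i hi => ?_, fun e he => ?_⟩
  · have := (Finset.sum_eq_sum_iff_of_le h1).1 (by omega) i (Finset.mem_univ i)
    rw [← this, if_neg hi]
  · exact ((Finset.sum_eq_sum_iff_of_le h2).1 (by omega) e he).symm

/-- A family is tight if its weight attains the maximal value compatible with each word sharing
an edge with another one. -/
structure IsTightFamily (w : ι → List ℕ) : Prop extends IsDoublyTraversed w where
  noLoop : ∀ e ∈ familyEdges w, ¬ e.IsDiag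
  shared : ∃ c, IsSharedChoice w c
  card_eq : Fintype.card ι + 2 * (familySupp w).card = ∑ i, ((w i).length - 1) + 2

namespace IsTightFamily

variable {w : ι → List ℕ}

lemma tight (hw : IsTightFamily w) [Nonempty ι] {τ : Finset (Sym2 ℕ)}
    (hτ : IsSpanningForest (familyEdges w) τ) {c : ι → Sym2 ℕ} (hc : IsSharedChoice w c) :
    (∀ i, ¬ edgeFinset (w i) ⊆ τ → ∑ e ∈ familyEdges w \ τ, trav (w i) e = 1) ∧
      ∀ e ∈ τ, familyTrav w e = (forestWordsAt w τ c e).card + 2 := by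
  refine eq_of_card_add_two_mul_eq hw.toIsDoublyTraversed hτ hc ?_
  have h1 := IsSpanningForest.card_add_one hw.closed hτ
  have h2 := hw.card_eq
  rw [familySupp, ← h1] at h2
  omega

lemma trav_le_one (hw : IsTightFamily w) {e : Sym2 ℕ} (he : e ∈ familyEdges w)
    (hb : ¬ IsBridgeIn (familyEdges w) e) (i : ι) : trav (w i) e ≤ 1 := by
  have : Nonempty ι := ⟨i⟩
  obtain ⟨c, hc⟩ := hw.shared
  obtain ⟨τ, hτ, heτ⟩ := exists_isSpanningForest_notMem hb
  by_cases hi : e ∈ edgeFinset (w i)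
  · rw [← (hw.tight hτ hc).1 i fun h => heτ (h hi)]
    exact Finset.single_le_sum (f := fun e => trav (w i) e) (fun _ _ => Nat.zero_le _)
      (Finset.mem_sdiff.2 ⟨he, heτ⟩)
  · simp [trav_eq_zero hi]

/-- Non-bridges of a tight family are traversed exactly twice. -/
lemma familyTrav_eq_two (hw : IsTightFamily w) [Nonempty ι] {e : Sym2 ℕ}
    (he : e ∈ familyEdges w) (hb : ¬ IsBridgeIn (familyEdges w) e) : familyTrav w e = 2 := by
  obtain ⟨c, hc⟩ := hw.shared
  obtain ⟨τ, hτ, heτ⟩ := exists_isSpanningForest_mem he (hw.noLoop e he)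
  rw [(hw.tight hτ hc).2 e heτ, Finset.card_eq_zero.2, zero_add]
  refine Finset.eq_empty_of_forall_notMem fun i hi => ?_
  obtain ⟨hsub, rfl⟩ := mem_forestWordsAt.1 hi
  have h1 := hw.trav_le_one he hb i
  have h2 := mem_edgeFinset.1 (hc i).1
  obtain ⟨k, hk⟩ := hτ.even_trav (hw.closed i) hsub (c i)
  omega

/-- A bridge shared by two words of a tight family is the only edge the first one shares. -/
lemma shared_bridge (hw : IsTightFamily w) {e : Sym2 ℕ} (hb : IsBridgeIn (familyEdges w) e)
    {i j : ι} (hij : j ≠ i) (hi : e ∈ edgeFinset (w i)) (hj : e ∈ edgeFinset (w j)) :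
    familyTrav w e ≤ 4 ∧ ∀ {k e'}, k ≠ i → e' ∈ edgeFinset (w i) → e' ∈ edgeFinset (w k) →
      e' = e := by
  classical
  have : Nonempty ι := ⟨i⟩
  have he := edgeFinset_subset_familyEdges w i hi
  have heven : ∀ k, Even (trav (w k) e) := fun k =>
    even_trav_of_isBridgeIn (hw.closed k) (edgeFinset_subset_familyEdges w k) hb
  obtain ⟨τ, hτ, heτ⟩ := exists_isSpanningForest_mem he (hw.noLoop e he)
  have h4 : 4 ≤ familyTrav w e := by
    have := two_mul_card_le_familyTrav (w := w) (e := e) (s := {j, i})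
      (by simp [hi, hj]) fun k _ => heven k
    rwa [Finset.card_pair hij] at this
  have key : ∀ c, IsSharedChoice w c → familyTrav w e ≤ 4 ∧ c i = e := fun c hc => by
    have hN := (hw.tight hτ hc).2 e heτ
    have hmem : ∀ k ∈ forestWordsAt w τ c e, e ∈ edgeFinset (w k) := fun k hk =>
      (mem_forestWordsAt.1 hk).2 ▸ (hc k).1
    have h1 := two_mul_card_le_familyTrav hmem fun k _ => heven k
    refine ⟨by omega, ?_⟩
    by_contra hne
    have h2 := two_mul_card_le_familyTrav (w := w) (e := e)
      (s := insert i (forestWordsAt w τ c e)) (by simpa [hi] using hmem) fun k _ => heven k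
    rw [Finset.card_insert_of_notMem fun h => hne (mem_forestWordsAt.1 h).2] at h2
    omega
  obtain ⟨c, hc⟩ := hw.shared
  refine ⟨(key c hc).1, fun {k e'} hki hi' hk' => ?_⟩
  have hc' : IsSharedChoice w (Function.update c i e') := fun l => by
    by_cases hl : l = i
    · subst hl
      simpa using ⟨hi', k, hki, hk'⟩
    · simpa [hl] using hc l
  simpa using (key _ hc').2

/-- In a tight family, each word shares edges with at most one other word. -/
lemma partner_unique (hw : IsTightFamily w) {i j k : ι} {e e' : Sym2 ℕ} (hji : j ≠ i)
    (hki : k ≠ i) (hi : e ∈ edgeFinset (w i)) (hj : e ∈ edgeFinset (w j))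
    (hi' : e' ∈ edgeFinset (w i)) (hk : e' ∈ edgeFinset (w k)) : j = k := by
  classical
  have : Nonempty ι := ⟨i⟩
  by_contra hjk
  have hsum : ∀ f, trav (w i) f + (trav (w j) f + trav (w k) f) ≤ familyTrav w f := fun f => by
    have := sum_trav_le_familyTrav w f {i, j, k}
    rwa [Finset.sum_insert (by simp [hji.symm, hki.symm]), Finset.sum_pair hjk] at this
  have bridge : ∀ f, IsBridgeIn (familyEdges w) f → f ∈ edgeFinset (w i) →
      f ∈ edgeFinset (w j) → f ∈ edgeFinset (w k) → familyTrav w f ≤ 4 → False := by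
    intro f hb hfi hfj hfk h4
    have := two_mul_card_le_familyTrav (w := w) (e := f) (s := {i, j, k})
      (by simp [hfi, hfj, hfk]) fun l _ =>
        even_trav_of_isBridgeIn (hw.closed l) (edgeFinset_subset_familyEdges w l) hb
    rw [Finset.card_insert_of_notMem (by simp [hji.symm, hki.symm]),
      Finset.card_pair hjk] at this
    omega
  by_cases hb : IsBridgeIn (familyEdges w) e
  · obtain ⟨h4, h⟩ := hw.shared_bridge hb hji hi hj
    obtain rfl := h hki hi' hk
    exact bridge _ hb hi hj hk h4
  by_cases hb' : IsBridgeIn (familyEdges w) e'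
  · obtain ⟨h4, h⟩ := hw.shared_bridge hb' hki hi' hk
    obtain rfl := h hji hi hj
    exact bridge _ hb' hi hj hk h4
  have he := edgeFinset_subset_familyEdges w i hi
  have he' := edgeFinset_subset_familyEdges w i hi'
  have hN' := hw.familyTrav_eq_two he' hb'
  have hs' := hsum e'
  have hti := hw.trav_le_one he hb i
  have htj := hw.trav_le_one he hb j
  have hti' := hw.trav_le_one he' hb' i
  rw [mem_edgeFinset] at hi hj hi' hk
  obtain ⟨τ, hτ, heτ⟩ := exists_isSpanningForest_notMem hb
  obtain ⟨c, hc⟩ := hw.shared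
  have hsub : ∀ l, trav (w l) e = 1 → edgeFinset (w l) ⊆ insert e τ := fun l hl f hf => by
    by_contra hfτ
    rw [Finset.mem_insert, not_or] at hfτ
    have h1 := (hw.tight hτ hc).1 l fun h => hfτ.2 (h hf)
    have h2 := Finset.sum_le_sum_of_subset (f := fun e => trav (w l) e)
      (s := {f, e}) (t := familyEdges w \ τ) (by
        intro g hg
        rcases Finset.mem_insert.1 hg with rfl | hg
        · exact Finset.mem_sdiff.2 ⟨edgeFinset_subset_familyEdges w l hf, hfτ.2⟩
        · rw [Finset.mem_singleton.1 hg]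
          exact Finset.mem_sdiff.2 ⟨he, heτ⟩)
    rw [Finset.sum_pair hfτ.1] at h2
    have h3 := mem_edgeFinset.1 hf
    omega
  have hti1 : trav (w i) e = 1 := by omega
  have htj1 : trav (w j) e = 1 := by omega
  rcases Finset.mem_insert.1 (hsub i hti1 (mem_edgeFinset.2 hi')) with rfl | he'τ
  · omega
  · have h := hτ.trav_mod_two (hw.closed i) (hw.closed j) heτ (hsub i hti1) (hsub j htj1)
      hti1 htj1 he'τ
    have hj0 : trav (w j) e' = 0 := by omega
    rw [hj0, show trav (w i) e' = 1 by omega] at h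
    simp at h

end IsTightFamily

end Family

/-! ### Pairs of words -/

lemma familyEdges_pair (w₁ w₂ : List ℕ) :
    familyEdges ![w₁, w₂] = edgeFinset w₁ ∪ edgeFinset w₂ := by
  ext e
  simp [familyEdges, Fin.exists_fin_two]

lemma familySupp_pair (w₁ w₂ : List ℕ) : familySupp ![w₁, w₂] = wsupp w₁ ∪ wsupp w₂ := by
  ext e
  simp [familySupp, Fin.exists_fin_two]

/-- The weight bound for weak CLT pairs. -/
lemma IsWeakCLTPair.two_mul_card_le {w₁ w₂ : List ℕ} (h : IsWeakCLTPair w₁ w₂) :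
    2 * (wsupp w₁ ∪ wsupp w₂).card ≤ (w₁.length - 1) + (w₂.length - 1) := by
  obtain ⟨h₁, h₂, htwo, e, he⟩ := h
  rw [Finset.mem_inter] at he
  have hw : IsDoublyTraversed ![w₁, w₂] :=
    ⟨by simp [Fin.forall_fin_two, h₁, h₂], fun e he => by
      rw [familyEdges_pair] at he
      simpa [familyTrav] using htwo e he⟩
  have hc : IsSharedChoice ![w₁, w₂] fun _ => e := fun i =>
    ⟨by fin_cases i <;> simp [he], 1 - i, by fin_cases i <;> simp, by fin_cases i <;> simp [he]⟩
  obtain ⟨τ, hτ⟩ := exists_isSpanningForest (familyEdges ![w₁, w₂])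
  have h1 := card_add_two_mul_le hw hτ hc
  have h2 := IsSpanningForest.card_add_one hw.closed hτ
  rw [← familySupp, familySupp_pair] at h2
  simp only [Fintype.card_fin, Fin.sum_univ_two, Matrix.cons_val_zero, Matrix.cons_val_one] at h1
  omega

/-- A finite linear order with a fixed-point-free involution splits into pairs. -/
lemma exists_pairing_equiv {ι : Type*} [Fintype ι] [LinearOrder ι] (π : ι → ι)
    (hπ : Function.Involutive π) (hne : ∀ i, π i ≠ i) :
    ∃ m, ∃ f : Fin m × Fin 2 ≃ ι, ∀ k, f (k, 1) = π (f (k, 0)) := by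
  classical
  let R := {i : ι // i < π i}
  let r : Fin (Fintype.card R) ≃ R := (Fintype.equivFin R).symm
  let g : Fin (Fintype.card R) × Fin 2 → ι := fun x =>
    if x.2 = 0 then (r x.1 : ι) else π (r x.1)
  have hg : Function.Bijective g := by
    constructor
    · rintro ⟨k, a⟩ ⟨l, b⟩ h
      have hk := (r k).2
      have hl := (r l).2
      fin_cases a <;> fin_cases b <;> simp [g] at h ⊢
      · exact r.injective (Subtype.ext h)
      · rw [h, hπ] at hk
        exact lt_asymm hk hl
      · rw [← h, hπ] at hl
        exact lt_asymm hk hl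
      · exact r.injective (Subtype.ext (hπ.injective h))
    · intro i
      rcases lt_or_gt_of_ne (hne i) with h | h
      · exact ⟨(r.symm ⟨π i, by rwa [hπ]⟩, 1), by simp [g, hπ i]⟩
      · exact ⟨(r.symm ⟨i, h⟩, 0), by simp [g]⟩
  exact ⟨_, Equiv.ofBijective g hg, fun k => by simp [g]⟩

lemma pairwise_disjoint_of_sum_card_le {ι α : Type*} [Fintype ι] [DecidableEq ι] [DecidableEq α]
    (A : ι → Finset α) (h : ∑ i, (A i).card ≤ (Finset.univ.biUnion A).card) {i j : ι}
    (hij : i ≠ j) : Disjoint (A i) (A j) := by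
  have h1 : Finset.univ.biUnion A = A i ∪ (Finset.univ.erase i).biUnion A := by
    rw [← Finset.biUnion_insert, Finset.insert_erase (Finset.mem_univ i)]
  have h2 := Finset.card_union_add_card_inter (A i) ((Finset.univ.erase i).biUnion A)
  have h3 : ((Finset.univ.erase i).biUnion A).card ≤ _ := Finset.card_biUnion_le
  rw [← Finset.add_sum_erase _ _ (Finset.mem_univ i), h1] at h
  have h4 : Disjoint (A i) ((Finset.univ.erase i).biUnion A) := by
    rw [Finset.disjoint_iff_inter_eq_empty, ← Finset.card_eq_zero]
    omega
  exact h4.mono_right (Finset.subset_biUnion_of_mem A (by simp [hij.symm]))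

/-- The pairs of words sharing an edge in a tight family are CLT pairs, with disjoint edge sets
and with supports meeting only in the letter `1`. -/
lemma IsTightFamily.exists_pairing {ι : Type*} [Fintype ι] [LinearOrder ι] {w : ι → List ℕ}
    (hw : IsTightFamily w) :
    ∃ m, ∃ f : Fin m × Fin 2 ≃ ι,
      (∀ k, IsCLTPair (w (f (k, 0))) (w (f (k, 1)))) ∧
      (∀ k l, k ≠ l → Disjoint
        (edgeFinset (w (f (k, 0))) ∪ edgeFinset (w (f (k, 1))))
        (edgeFinset (w (f (l, 0))) ∪ edgeFinset (w (f (l, 1))))) ∧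
      (∀ k l, k ≠ l → Disjoint
        ((wsupp (w (f (k, 0))) ∪ wsupp (w (f (k, 1)))) \ {1})
        ((wsupp (w (f (l, 0))) ∪ wsupp (w (f (l, 1)))) \ {1})) := by
  obtain ⟨c, hc⟩ := hw.shared
  choose hc₁ π hπne hπ using hc
  have huniq : ∀ {i j e}, e ∈ edgeFinset (w i) → e ∈ edgeFinset (w j) → j ≠ i → j = π i :=
    fun {i j e} hi hj hji => hw.partner_unique hji (hπne i) hi hj (hc₁ i) (hπ i)
  have hinv : Function.Involutive π := fun i => (huniq (hπ i) (hc₁ i) (hπne i).symm).symm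
  obtain ⟨m, f, hf⟩ := exists_pairing_equiv π hinv hπne
  have hf' : ∀ k, f (k, 0) = π (f (k, 1)) := fun k => by rw [hf, hinv]
  have hoff : ∀ {k l a b e}, k ≠ l → e ∈ edgeFinset (w (f (k, a))) →
      e ∉ edgeFinset (w (f (l, b))) := fun {k l a b e} hkl hk hl => by
    have h := huniq hk hl fun h => hkl (Prod.ext_iff.1 (f.injective h)).1.symm
    have h' : f (k, 1 - a) = π (f (k, a)) := by
      fin_cases a
      · exact hf k
      · exact hf' k
    rw [← h'] at h
    exact hkl (Prod.ext_iff.1 (f.injective h)).1.symm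
  have hsum : ∀ g : ι → ℕ, ∑ i, g i = ∑ k, (g (f (k, 0)) + g (f (k, 1))) := fun g => by
    rw [← f.sum_comp, Fintype.sum_prod_type]
    simp [Fin.sum_univ_two]
  have hweak : ∀ k, IsWeakCLTPair (w (f (k, 0))) (w (f (k, 1))) := fun k => by
    refine ⟨hw.closed _, hw.closed _, fun e he => ?_, c (f (k, 0)),
      Finset.mem_inter.2 ⟨hc₁ _, hf k ▸ hπ _⟩⟩
    have he' : e ∈ familyEdges w := Finset.union_subset (edgeFinset_subset_familyEdges w _)
      (edgeFinset_subset_familyEdges w _) he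
    have h2 := hw.two_le e he'
    rw [familyTrav, hsum, Finset.sum_eq_single k] at h2
    · exact h2
    · intro l _ hl
      rcases Finset.mem_union.1 he with he | he <;>
        rw [trav_eq_zero (hoff hl.symm he), trav_eq_zero (hoff hl.symm he), add_zero]
    · simp
  set V : Fin m → Finset ℕ := fun k => wsupp (w (f (k, 0))) ∪ wsupp (w (f (k, 1))) with hV
  have hbound : ∀ k ∈ Finset.univ, 2 * (V k).card ≤
      ((w (f (k, 0))).length - 1) + ((w (f (k, 1))).length - 1) :=
    fun k _ => (hweak k).two_mul_card_le
  have hone : ∀ k, 1 ∈ V k := fun k => Finset.mem_union_left _ (hw.closed _).one_mem_wsupp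
  have hA : ∀ k, (V k).card = (V k \ {1}).card + 1 := fun k => by
    rw [Finset.sdiff_singleton_eq_erase, Finset.card_erase_add_one (hone k)]
  have hU : (Finset.univ.biUnion fun k => V k \ {1}) = familySupp w \ {1} := by
    ext v
    simp only [Finset.mem_biUnion, Finset.mem_univ, true_and, Finset.mem_sdiff, familySupp, hV,
      Finset.mem_union, Finset.mem_singleton]
    constructor
    · rintro ⟨k, h | h, h1⟩
      exacts [⟨⟨_, h⟩, h1⟩, ⟨⟨_, h⟩, h1⟩]
    · rintro ⟨⟨i, hi⟩, h1⟩
      obtain ⟨⟨k, a⟩, rfl⟩ := f.surjective i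
      refine ⟨k, ?_, h1⟩
      fin_cases a
      exacts [Or.inl hi, Or.inr hi]
  have hcardι : Fintype.card ι = 2 * m := by
    rw [← Fintype.card_congr f]
    simp [mul_comm]
  have hcard := hw.card_eq
  rw [hsum, hcardι] at hcard
  have hle := Finset.sum_le_sum hbound
  have hle' : (Finset.univ.biUnion fun k => V k \ {1}).card ≤ ∑ k, (V k \ {1}).card :=
    Finset.card_biUnion_le
  have hS : ∑ k, 2 * (V k).card = 2 * ∑ k, (V k \ {1}).card + 2 * m := by
    simp only [hA]
    rw [← Finset.mul_sum, Finset.sum_add_distrib]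
    simp [mul_add]
  have hUcard : (familySupp w).card ≤ (familySupp w \ {1}).card + 1 := by
    simpa using Finset.card_le_card_sdiff_add_card (s := familySupp w) (t := {1})
  have hUcard' : 1 ≤ m → (familySupp w \ {1}).card + 1 = (familySupp w).card := fun hm => by
    rw [Finset.sdiff_singleton_eq_erase, Finset.card_erase_add_one]
    exact Finset.mem_biUnion.2 ⟨f (⟨0, hm⟩, 0), Finset.mem_univ _, (hw.closed _).one_mem_wsupp⟩
  refine ⟨m, f, fun k => ⟨hweak k, ?_⟩, fun k l hkl => ?_, fun k l hkl => ?_⟩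
  · have hm := hUcard' (by have := k.isLt; omega)
    rw [hU] at hle'
    have h := (Finset.sum_eq_sum_iff_of_le hbound).1 (by omega) k (Finset.mem_univ k)
    have h0 := List.length_pos_iff.2 (hw.closed (f (k, 0))).1
    have h1 := List.length_pos_iff.2 (hw.closed (f (k, 1))).1
    have h2 : 2 * (V k).card + 2 = (w (f (k, 0))).length + (w (f (k, 1))).length := by omega
    have h3 : (2 * (V k).card + 2 : ℚ) = (w (f (k, 0))).length + (w (f (k, 1))).length := by
      exact_mod_cast h2
    linarith
  · rw [Finset.disjoint_left]
    intro e he he'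
    rcases Finset.mem_union.1 he with he | he <;> rcases Finset.mem_union.1 he' with he' | he' <;>
      exact hoff hkl he he'
  · refine pairwise_disjoint_of_sum_card_le (fun k => V k \ {1}) ?_ hkl
    rw [hU]
    omega

/-! ### Sentences as families of words -/

lemma sentTrav_eq_familyTrav (a : List (List ℕ)) (e : Sym2 ℕ) :
    sentTrav a e = familyTrav a.get e := by
  rw [sentTrav, sentEdgeList, List.count_flatten, List.map_map, familyTrav,
    ← Fin.sum_univ_fun_getElem]
  rfl

lemma sentEdgeFinset_eq_familyEdges (a : List (List ℕ)) :
    sentEdgeFinset a = familyEdges a.get := by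
  ext e
  simpa [sentEdgeFinset, sentEdgeList, familyEdges, edgeFinset] using
    List.exists_mem_iff_get (p := fun w => e ∈ edgeList w)

lemma sentSupp_eq_familySupp (a : List (List ℕ)) : sentSupp a = familySupp a.get := by
  ext v
  simpa [sentSupp, familySupp, wsupp] using List.exists_mem_iff_get (p := fun w => v ∈ w)

lemma IsCLTSentence.isTightFamily {a : List (List ℕ)} (h : IsCLTSentence a)
    (hself : ∀ w ∈ a, ∀ e ∈ edgeFinset w, ¬ e.IsDiag) : IsTightFamily a.get := by
  obtain ⟨⟨-, hclosed, htwo, hshare⟩, hcard⟩ := h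
  have hcl : ∀ i, IsClosedWordAtOne (a.get i) := fun i => hclosed _ (List.get_mem a i)
  refine ⟨⟨hcl, fun e he => ?_⟩, fun e he => ?_, ?_, ?_⟩
  · rw [← sentTrav_eq_familyTrav]
    exact htwo e (by rwa [sentEdgeFinset_eq_familyEdges])
  · obtain ⟨i, -, hi⟩ := Finset.mem_biUnion.1 he
    exact hself _ (List.get_mem a i) e hi
  · choose j hj c hc using hshare
    exact ⟨c, fun i => ⟨Finset.mem_of_mem_inter_left (hc i), j i, hj i,
      Finset.mem_of_mem_inter_right (hc i)⟩⟩
  · have h1 : ∀ i, (((a.get i).length - 1 : ℕ) : ℚ) = ((a.get i).length : ℚ) - 1 := fun i =>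
      Nat.cast_pred (List.length_pos_iff.2 (hcl i).1)
    have h2 : ((∑ i, ((a.get i).length - 1) : ℕ) : ℚ) =
        2 * ∑ i, (((a.get i).length : ℚ) - 2) / 2 + a.length := by
      have hlen : ∑ _i : Fin a.length, (1 : ℚ) = a.length := by simp
      rw [Nat.cast_sum, Finset.mul_sum, ← hlen, ← Finset.sum_add_distrib]
      refine Finset.sum_congr rfl fun i _ => ?_
      rw [h1]
      ring
    rw [sentSupp_eq_familySupp] at hcard
    rw [Fintype.card_fin, ← Nat.cast_inj (R := ℚ)]
    push_cast [h2, hcard] at *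
    linarith

/-- **Perfect matching structure of CLT sentences.** If `a = (w₁, …, wₙ)` is a CLT sentence
whose words contain no self-edge, then `n` is even, say `n = 2m`, and there is a permutation
`σ` of `{1, …, n}` such that (a) each `(w_{σ(2i-1)}, w_{σ(2i)})` is a CLT pair; (b) the edge
sets of the graphs of these pairs are pairwise disjoint; (c) the vertex sets of the graphs of
these pairs, each with the vertex `1` removed, are pairwise disjoint. -/
theorem CLT_sentence_matching (a : List (List ℕ)) (h : IsCLTSentence a)
    (hself : ∀ w ∈ a, ∀ e ∈ edgeFinset w, ¬ e.IsDiag) :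
    ∃ m : ℕ, ∃ hm : a.length = 2 * m, ∃ σ : Equiv.Perm (Fin (2 * m)),
      (∀ i : Fin m,
        IsCLTPair (a.get (Fin.cast hm.symm (σ ⟨2 * i.1, by have := i.isLt; omega⟩)))
          (a.get (Fin.cast hm.symm (σ ⟨2 * i.1 + 1, by have := i.isLt; omega⟩)))) ∧
      (∀ i j : Fin m, i ≠ j →
        Disjoint
          (edgeFinset (a.get (Fin.cast hm.symm (σ ⟨2 * i.1, by have := i.isLt; omega⟩))) ∪
            edgeFinset (a.get (Fin.cast hm.symm (σ ⟨2 * i.1 + 1, by have := i.isLt; omega⟩))))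
          (edgeFinset (a.get (Fin.cast hm.symm (σ ⟨2 * j.1, by have := j.isLt; omega⟩))) ∪
            edgeFinset (a.get (Fin.cast hm.symm (σ ⟨2 * j.1 + 1, by have := j.isLt; omega⟩))))) ∧
      (∀ i j : Fin m, i ≠ j →
        Disjoint
          ((wsupp (a.get (Fin.cast hm.symm (σ ⟨2 * i.1, by have := i.isLt; omega⟩))) ∪
            wsupp (a.get (Fin.cast hm.symm (σ ⟨2 * i.1 + 1, by have := i.isLt; omega⟩)))) \ {1})
          ((wsupp (a.get (Fin.cast hm.symm (σ ⟨2 * j.1, by have := j.isLt; omega⟩))) ∪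
            wsupp (a.get (Fin.cast hm.symm (σ ⟨2 * j.1 + 1, by have := j.isLt; omega⟩)))) \ {1})) := by
  obtain ⟨m, f, hpair, hedge, hvert⟩ := (h.isTightFamily hself).exists_pairing
  have hm : a.length = 2 * m := by
    simpa [mul_comm] using (Fintype.card_congr f).symm
  let σ : Equiv.Perm (Fin (2 * m)) :=
    (finCongr (mul_comm 2 m)).trans (finProdFinEquiv.symm.trans (f.trans (finCongr hm)))
  have h0 : ∀ (i : Fin m) (hi : 2 * i.1 < 2 * m),
      Fin.cast hm.symm (σ ⟨2 * i.1, hi⟩) = f (i, 0) := fun i hi => by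
    have : finProdFinEquiv.symm (Fin.cast (mul_comm 2 m) ⟨2 * i.1, hi⟩) = (i, (0 : Fin 2)) := by
      rw [Equiv.symm_apply_eq]
      ext
      simp
    change Fin.cast _ (Fin.cast hm (f (finProdFinEquiv.symm
      (Fin.cast (mul_comm 2 m) ⟨2 * i.1, hi⟩)))) = _
    rw [this]
    rfl
  have h1 : ∀ (i : Fin m) (hi : 2 * i.1 + 1 < 2 * m),
      Fin.cast hm.symm (σ ⟨2 * i.1 + 1, hi⟩) = f (i, 1) := fun i hi => by
    have : finProdFinEquiv.symm (Fin.cast (mul_comm 2 m) ⟨2 * i.1 + 1, hi⟩) =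
        (i, (1 : Fin 2)) := by
      rw [Equiv.symm_apply_eq]
      ext
      simp [add_comm]
    change Fin.cast _ (Fin.cast hm (f (finProdFinEquiv.symm
      (Fin.cast (mul_comm 2 m) ⟨2 * i.1 + 1, hi⟩)))) = _
    rw [this]
    rfl
  refine ⟨m, hm, σ, fun i => ?_, fun i j hij => ?_, fun i j hij => ?_⟩
  · rw [h0, h1]
    exact hpair i
  · rw [h0, h1, h0, h1]
    exact hedge i j hij
  · rw [h0, h1, h0, h1]
    exact hvert i j hij
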